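/- arXiv:0710.0815 — 9 statements merged into one kernel-verified Lean document; each statement's English description precedes it below -/
import Mathlib

section
/- If two spatial matrices 𝒜 and ℬ of size m×n×q over a field F are equivalent, then m'(𝒜) = m'(ℬ), n'(𝒜) = n'(ℬ), and q'(𝒜) = q'(ℬ); that is, the dimensions of the spans of the slices in each of the three directions are invariants of equivalence. -/
/-- Two spatial matrices of size m×n×q over a field `F` are *equivalent* if there exist
invertible matrices `R`, `S`, `T` with
`B i' j' k' = ∑ i j k, A i j k * R i i' * S j j' * T k k'`. -/
def SpatialEquiv {m n q : ℕ} (F : Type*) [Field F]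
    (A B : Fin m → Fin n → Fin q → F) : Prop :=
  ∃ (R : Matrix (Fin m) (Fin m) F) (S : Matrix (Fin n) (Fin n) F)
    (T : Matrix (Fin q) (Fin q) F),
    IsUnit R ∧ IsUnit S ∧ IsUnit T ∧
    ∀ i' j' k', B i' j' k' = ∑ i, ∑ j, ∑ k, A i j k * R i i' * S j j' * T k k'

/-- A spatial matrix is *regular* if the slices in each of the three directions are
linearly independent families of matrices. -/
def SpatialRegular {m n q : ℕ} (F : Type*) [Field F]
    (A : Fin m → Fin n → Fin q → F) : Prop :=
  LinearIndependent F (fun i => Matrix.of fun j k => A i j k) ∧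
  LinearIndependent F (fun j => Matrix.of fun i k => A i j k) ∧
  LinearIndependent F (fun k => Matrix.of fun i j => A i j k)

/-- The dimension of the span of the frontal slices. -/
noncomputable def qDim {m n q : ℕ} (F : Type*) [Field F]
    (A : Fin m → Fin n → Fin q → F) : ℕ :=
  Module.finrank F (Submodule.span F
    (Set.range fun k => (Matrix.of fun i j => A i j k : Matrix (Fin m) (Fin n) F)))

/-- The dimension of the span of the lateral slices. -/
noncomputable def nDim {m n q : ℕ} (F : Type*) [Field F]
    (A : Fin m → Fin n → Fin q → F) : ℕ :=
  Module.finrank F (Submodule.span F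
    (Set.range fun j => (Matrix.of fun i k => A i j k : Matrix (Fin m) (Fin q) F)))

/-- The dimension of the span of the horizontal slices. -/
noncomputable def mDim {m n q : ℕ} (F : Type*) [Field F]
    (A : Fin m → Fin n → Fin q → F) : ℕ :=
  Module.finrank F (Submodule.span F
    (Set.range fun i => (Matrix.of fun j k => A i j k : Matrix (Fin n) (Fin q) F)))

theorem aux_le {F : Type*} [Field F] {a b c : ℕ} (f g : Fin a → Matrix (Fin b) (Fin c) F)
    (T : Matrix (Fin a) (Fin a) F) (P : Matrix (Fin b) (Fin b) F) (Q : Matrix (Fin c) (Fin c) F)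
    (h : ∀ k', g k' = ∑ k, T k k' • (P * f k * Q)) :
    Module.finrank F (Submodule.span F (Set.range g)) ≤
      Module.finrank F (Submodule.span F (Set.range f)) := by
  let L : Matrix (Fin b) (Fin c) F →ₗ[F] Matrix (Fin b) (Fin c) F :=
    { toFun := fun M => P * M * Q
      map_add' := fun x y => by rw [Matrix.mul_add, Matrix.add_mul]
      map_smul' := fun r x => by simp }
  have h1 : Submodule.span F (Set.range g) ≤ (Submodule.span F (Set.range f)).map L := by
    rw [Submodule.span_le]
    rintro _ ⟨k', rfl⟩
    rw [h]
    exact Submodule.sum_mem _ fun k _ => Submodule.smul_mem _ _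
      (Submodule.mem_map_of_mem (f := L) (Submodule.subset_span ⟨k, rfl⟩))
  exact (Submodule.finrank_mono h1).trans (Submodule.finrank_map_le L _)

theorem aux_eq {F : Type*} [Field F] {a b c : ℕ} (f g : Fin a → Matrix (Fin b) (Fin c) F)
    (T : Matrix (Fin a) (Fin a) F) (P : Matrix (Fin b) (Fin b) F) (Q : Matrix (Fin c) (Fin c) F)
    (hT : IsUnit T) (hP : IsUnit P) (hQ : IsUnit Q)
    (h : ∀ k', g k' = ∑ k, T k k' • (P.transpose * f k * Q)) :
    Module.finrank F (Submodule.span F (Set.range f)) =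
      Module.finrank F (Submodule.span F (Set.range g)) := by
  refine le_antisymm ?_ (aux_le f g T _ Q h)
  obtain ⟨T', hT'⟩ := hT.exists_right_inv
  obtain ⟨P', hP'⟩ := hP.exists_right_inv
  obtain ⟨Q', hQ'⟩ := hQ.exists_right_inv
  refine aux_le g f T' P'.transpose Q' fun l => ?_
  have e : ∀ k, P'.transpose * (P.transpose * f k * Q) * Q' = f k := fun k => by
    have : P'.transpose * P.transpose = 1 := by
      rw [← Matrix.transpose_mul, hP', Matrix.transpose_one]
    rw [Matrix.mul_assoc P.transpose, ← Matrix.mul_assoc P'.transpose, this, Matrix.one_mul,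
      Matrix.mul_assoc, hQ', Matrix.mul_one]
  simp only [h, Matrix.mul_sum, Matrix.sum_mul, Matrix.mul_smul, Matrix.smul_mul, e,
    Finset.smul_sum, smul_smul]
  rw [Finset.sum_comm]
  have e2 : ∀ k, ∑ x, (T' x l * T k x) • f k = (1 : Matrix (Fin a) (Fin a) F) k l • f k :=
    fun k => by
      rw [← hT', Matrix.mul_apply, Finset.sum_smul]
      simp only [mul_comm]
  simp [e2, Matrix.one_apply]

/-- The dimensions of the spans of the slices in each of the three directions are
invariants of equivalence. -/
theorem stmt_1 {m n q : ℕ} (F : Type*) [Field F]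
    (A B : Fin m → Fin n → Fin q → F) (h : SpatialEquiv F A B) :
    mDim F A = mDim F B ∧ nDim F A = nDim F B ∧ qDim F A = qDim F B := by
  obtain ⟨R, S, T, hR, hS, hT, h⟩ := h
  refine ⟨aux_eq _ _ R S T hR hS hT fun x => ?_, aux_eq _ _ S R T hS hR hT fun x => ?_,
    aux_eq _ _ T R S hT hR hS fun x => ?_⟩
  · ext y z
    simp only [Matrix.of_apply, h, Matrix.sum_apply, Matrix.smul_apply, Matrix.mul_apply,
      Matrix.transpose_apply, smul_eq_mul, Finset.mul_sum, Finset.sum_mul]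
    refine Finset.sum_congr rfl fun i _ => ?_
    rw [Finset.sum_comm]
    refine Finset.sum_congr rfl fun j _ => Finset.sum_congr rfl fun k _ => ?_
    ring
  · ext y z
    simp only [Matrix.of_apply, h, Matrix.sum_apply, Matrix.smul_apply, Matrix.mul_apply,
      Matrix.transpose_apply, smul_eq_mul, Finset.mul_sum, Finset.sum_mul]
    rw [Finset.sum_comm]
    refine Finset.sum_congr rfl fun i _ => ?_
    rw [Finset.sum_comm]
    refine Finset.sum_congr rfl fun j _ => Finset.sum_congr rfl fun k _ => ?_
    ring
  · ext y z
    simp only [Matrix.of_apply, h, Matrix.sum_apply, Matrix.smul_apply, Matrix.mul_apply,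
      Matrix.transpose_apply, smul_eq_mul, Finset.mul_sum, Finset.sum_mul]
    conv_rhs =>
      enter [2, k]
      rw [Finset.sum_comm]
    conv_rhs => rw [Finset.sum_comm]
    refine Finset.sum_congr rfl fun i _ => ?_
    rw [Finset.sum_comm]
    refine Finset.sum_congr rfl fun j _ => Finset.sum_congr rfl fun k _ => ?_
    ring
end

section
/- Every regular spatial matrix of size 2×1×2 over a field F is equivalent to the 2×1×2 spatial matrix ℬ with ℬ i 0 k = 1 if i = k and 0 otherwise (the spatial matrix whose two frontal slices are the columns (1,0)ᵀ and (0,1)ᵀ). -/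
/-- Every regular 2×1×2 spatial matrix is equivalent to the one whose two frontal
slices are the columns `(1,0)ᵀ` and `(0,1)ᵀ`. -/
theorem stmt_6 (F : Type*) [Field F]
    (A : Fin 2 → Fin 1 → Fin 2 → F) (h : SpatialRegular F A) :
    SpatialEquiv F A (fun i _ k => if i = k then (1 : F) else 0) := by
  obtain ⟨h1, -, -⟩ := h
  have hM : IsUnit (Matrix.of fun i k => A i 0 k : Matrix (Fin 2) (Fin 2) F) := by
    rw [← Matrix.linearIndependent_rows_iff_isUnit]
    rw [Fintype.linearIndependent_iff] at h1 ⊢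
    intro g hg
    apply h1 g
    ext j k
    have := congrFun hg k
    have hj : j = 0 := Subsingleton.elim _ _
    subst hj
    simpa [Fin.sum_univ_two, Matrix.row] using this
  refine ⟨1, 1, (Matrix.of fun i k => A i 0 k : Matrix (Fin 2) (Fin 2) F)⁻¹,
    isUnit_one, isUnit_one, ?_, ?_⟩
  · exact (Matrix.isUnit_nonsing_inv_iff).2 hM
  · intro i j k
    have hmul := Matrix.mul_nonsing_inv _ ((Matrix.isUnit_iff_isUnit_det _).1 hM)
    have e := congrFun (congrFun hmul i) k
    have hj : j = 0 := Subsingleton.elim _ _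
    subst hj
    rw [Matrix.mul_apply, Matrix.one_apply] at e
    simp only [← e]
    fin_cases i <;> simp [Fin.sum_univ_two, Matrix.one_apply]
end

section
/- Let F be a field of characteristic different from 2. Every regular spatial matrix of size 2×2×2 over F is equivalent to ‖I₂ | B(a)‖ for some a ∈ F. -/
/-- The m×2×2 spatial matrix whose two frontal slices are `A` and `B`. -/
def pairSlices {m : ℕ} {F : Type*} [Field F] (A B : Matrix (Fin m) (Fin 2) F) :
    Fin m → Fin 2 → Fin 2 → F :=
  fun i j k => ![A, B] k i j

theorem li_pair {F V : Type*} [Field F] [AddCommGroup V] [Module F V] {f : Fin 2 → V}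
    (h : LinearIndependent F f) (s t : F) (hst : s • f 0 + t • f 1 = 0) : s = 0 ∧ t = 0 := by
  have e : f = ![f 0, f 1] := by
    ext i
    fin_cases i <;> rfl
  rw [e, LinearIndependent.pair_iff] at h
  exact h s t hst

theorem rank_one_aux {F : Type*} [Field F] (a b c d : F) (h : a * d - b * c = 0) :
    ∃ u0 u1 v0 v1 : F, a = u0 * v0 ∧ b = u0 * v1 ∧ c = u1 * v0 ∧ d = u1 * v1 := by
  by_cases ha : a = 0
  · subst ha
    by_cases hb : b = 0
    · subst hb
      exact ⟨0, 1, c, d, by simp, by simp, by simp, by simp⟩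
    · have hc : c = 0 := by
        have : b * c = 0 := by linear_combination -h
        exact (mul_eq_zero.mp this).resolve_left hb
      exact ⟨b, d, 0, 1, by simp, by simp, by simp [hc], by simp⟩
  · refine ⟨a, c, 1, b / a, by simp, by field_simp, by simp, ?_⟩
    field_simp
    linear_combination h

theorem par_aux {F : Type*} [Field F] (u0 u1 w0 w1 : F) (h : u0 * w1 - u1 * w0 = 0) :
    ∃ s t : F, ¬ (s = 0 ∧ t = 0) ∧ s * u0 + t * u1 = 0 ∧ s * w0 + t * w1 = 0 := by
  by_cases hu : u0 = 0 ∧ u1 = 0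
  · by_cases hw : w0 = 0 ∧ w1 = 0
    · exact ⟨1, 0, by simp, by simp [hu], by simp [hw]⟩
    · refine ⟨w1, -w0, fun hh => hw ⟨by simpa using hh.2, hh.1⟩, by simp [hu], by ring⟩
  · refine ⟨u1, -u0, fun hh => hu ⟨by simpa using hh.2, hh.1⟩, by ring, by linear_combination -h⟩

theorem exists_pencil {F : Type*} [Field F] (A : Fin 2 → Fin 2 → Fin 2 → F)
    (h : SpatialRegular F A) :
    ∃ x y z w : F, x * w - z * y ≠ 0 ∧
      (x * A 0 0 0 + y * A 0 0 1) * (x * A 1 1 0 + y * A 1 1 1)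
        - (x * A 0 1 0 + y * A 0 1 1) * (x * A 1 0 0 + y * A 1 0 1) ≠ 0 := by
  by_contra! hc
  have h0 := hc 1 0 0 1 (by simp)
  have h1 := hc 0 1 1 0 (by simp)
  have h2 := hc 1 1 0 1 (by simp)
  simp only [one_mul, zero_mul, add_zero, zero_add] at h0 h1 h2
  obtain ⟨r, c, -⟩ := h
  replace r := li_pair r
  replace c := li_pair c
  obtain ⟨u0, u1, v0, v1, e1, e2, e3, e4⟩ := rank_one_aux _ _ _ _ h0
  obtain ⟨p0, p1, q0, q1, f1, f2, f3, f4⟩ := rank_one_aux _ _ _ _ h1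
  rw [e1, e2, e3, e4, f1, f2, f3, f4] at h2
  have : (u0 * p1 - u1 * p0) * (v0 * q1 - v1 * q0) = 0 := by linear_combination h2
  rcases mul_eq_zero.mp this with h | h
  · obtain ⟨s, t, hn, k1, k2⟩ := par_aux _ _ _ _ h
    refine hn (r s t ?_)
    ext j k
    fin_cases j <;> fin_cases k <;> simp [e1, e2, e3, e4, f1, f2, f3, f4]
    · linear_combination v0 * k1
    · linear_combination q0 * k2
    · linear_combination v1 * k1
    · linear_combination q1 * k2
  · obtain ⟨s, t, hn, k1, k2⟩ := par_aux _ _ _ _ h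
    refine hn (c s t ?_)
    ext j k
    fin_cases j <;> fin_cases k <;> simp [e1, e2, e3, e4, f1, f2, f3, f4]
    · linear_combination u0 * k1
    · linear_combination p0 * k2
    · linear_combination u1 * k1
    · linear_combination p1 * k2

theorem traceless_aux {F : Type*} [Field F] (hchar : (2 : F) ≠ 0) (p q r : F)
    (h : ¬ (p = 0 ∧ q = 0 ∧ r = 0)) :
    ∃ (a : F) (S : Matrix (Fin 2) (Fin 2) F), S.det ≠ 0 ∧
      !![p, q; r, -p] * S = S * !![0, a; 1, 0] := by
  refine ⟨p ^ 2 + q * r, ?_⟩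
  have key : ∀ v0 v1 : F, !![p, q; r, -p] * !![v0, p * v0 + q * v1; v1, r * v0 - p * v1]
      = !![v0, p * v0 + q * v1; v1, r * v0 - p * v1] * !![0, p ^ 2 + q * r; 1, 0] := by
    intro v0 v1
    ext i j
    fin_cases i <;> fin_cases j <;> simp [Matrix.mul_apply, Fin.sum_univ_two] <;> ring
  by_cases hr : r = 0
  · by_cases hq : q = 0
    · refine ⟨_, ?_, key 1 1⟩
      have hp : p ≠ 0 := fun hp => h ⟨hp, hq, hr⟩
      rw [Matrix.det_fin_two_of, hr, hq]
      have := mul_ne_zero hchar hp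
      intro h'
      apply this
      linear_combination -h'
    · refine ⟨_, ?_, key 0 1⟩
      rw [Matrix.det_fin_two_of]
      simpa using hq
  · refine ⟨_, ?_, key 1 0⟩
    rw [Matrix.det_fin_two_of]
    simpa using hr

theorem pencil_normal {F : Type*} [Field F] (hchar : (2 : F) ≠ 0)
    (M N : Matrix (Fin 2) (Fin 2) F) (hM : M.det ≠ 0) (hN : ∀ t : F, N - t • M ≠ 0) :
    ∃ (t a : F) (S : Matrix (Fin 2) (Fin 2) F), S.det ≠ 0 ∧
      (N - t • M) * S = M * S * !![0, a; 1, 0] := by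
  have hu : IsUnit M.det := hM.isUnit
  set C := M⁻¹ * N with hC
  have hMC : M * C = N := by rw [hC, Matrix.mul_nonsing_inv_cancel_left _ _ hu]
  set t := (C 0 0 + C 1 1) / 2 with ht
  have ht2 : 2 * t = C 0 0 + C 1 1 := by rw [ht]; field_simp
  have hD : C - t • (1 : Matrix (Fin 2) (Fin 2) F)
      = !![C 0 0 - t, C 0 1; C 1 0, -(C 0 0 - t)] := by
    ext i j
    fin_cases i <;> fin_cases j <;> simp
    linear_combination -ht2
  have hND : N - t • M = M * (C - t • (1 : Matrix (Fin 2) (Fin 2) F)) := by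
    rw [mul_sub, hMC]; simp
  obtain ⟨a, S, hS, hE⟩ := traceless_aux hchar (C 0 0 - t) (C 0 1) (C 1 0) (by
    rintro ⟨h1, h2, h3⟩
    apply hN t
    rw [hND, hD, h1, h2, h3]
    ext i j
    fin_cases i <;> fin_cases j <;> simp [Matrix.mul_apply])
  exact ⟨t, a, S, hS, by rw [hND, hD, mul_assoc, hE, mul_assoc]⟩

theorem stmt_7 (F : Type*) [Field F] (hchar : (2 : F) ≠ 0)
    (A : Fin 2 → Fin 2 → Fin 2 → F) (h : SpatialRegular F A) :
    ∃ a : F, SpatialEquiv F A (pairSlices (1 : Matrix (Fin 2) (Fin 2) F) !![0, a; 1, 0]) := by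
  obtain ⟨x, y, z, w, hd, hM⟩ := exists_pencil A h
  obtain ⟨-, -, hk⟩ := h
  replace hk := li_pair hk
  set A0 : Matrix (Fin 2) (Fin 2) F := Matrix.of fun i j => A i j 0 with hA0
  set A1 : Matrix (Fin 2) (Fin 2) F := Matrix.of fun i j => A i j 1 with hA1
  obtain ⟨t, a, S, hS, hE⟩ := pencil_normal hchar (x • A0 + y • A1) (z • A0 + w • A1)
    (by rw [Matrix.det_fin_two]; simpa [hA0, hA1] using hM) (by
      intro t ht
      have := hk (z - t * x) (w - t * y) (by rw [← ht]; module)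
      apply hd
      linear_combination x * this.2 - y * this.1)
  set M := x • A0 + y • A1 with hMdef
  have hMd : M.det ≠ 0 := by rw [Matrix.det_fin_two]; simpa [hMdef, hA0, hA1] using hM
  have hMS : IsUnit (M * S).det := by
    rw [Matrix.det_mul]; exact (mul_ne_zero hMd hS).isUnit
  set U := (M * S)⁻¹ with hU
  have hU1 : U * (M * S) = 1 := Matrix.nonsing_inv_mul _ hMS
  have hU2 : U * ((z • A0 + w • A1 - t • M) * S) = !![0, a; 1, 0] := by
    rw [hE, ← mul_assoc, hU1, one_mul]
  have hUu : IsUnit U := by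
    rw [Matrix.isUnit_iff_isUnit_det]; exact Matrix.isUnit_nonsing_inv_det _ hMS
  refine ⟨a, U.transpose, S, !![x, z - t * x; y, w - t * y], ?_, ?_, ?_, ?_⟩
  · rw [Matrix.isUnit_iff_isUnit_det, Matrix.det_transpose]
    exact (Matrix.isUnit_iff_isUnit_det _).mp hUu
  · rw [Matrix.isUnit_iff_isUnit_det]; exact hS.isUnit
  · rw [Matrix.isUnit_iff_isUnit_det, Matrix.det_fin_two_of]
    refine IsUnit.mk0 _ fun h' => hd ?_
    linear_combination h'
  · intro i j k
    fin_cases k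
    · change (1 : Matrix (Fin 2) (Fin 2) F) i j = _
      rw [← hU1]
      simp [Matrix.mul_apply, Fin.sum_univ_two, hMdef, hA0, hA1]
      ring
    · change !![0, a; 1, 0] i j = _
      rw [← hU2]
      simp [Matrix.mul_apply, Fin.sum_univ_two, hMdef, hA0, hA1]
      ring
end

section
/- Let F be a field of characteristic different from 2. Every regular spatial matrix of size 3×2×2 over F is equivalent to exactly one of the two 3×2×2 spatial matrices with pairs of frontal slices: (‖1 0; 0 1; 0 0‖, ‖0 0; 0 0; 0 1‖) (form (a12)) and (‖1 0; 0 1; 0 0‖, ‖0 0; 1 0; 0 1‖) (form (a12a)). -/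
open Matrix in
lemma aux_iff (F : Type*) [Field F] (A B : Fin 3 → Fin 2 → Fin 2 → F)
    (R : Matrix (Fin 3) (Fin 3) F) (S T : Matrix (Fin 2) (Fin 2) F) :
    (∀ i' j' k', B i' j' k' = ∑ i, ∑ j, ∑ k, A i j k * R i i' * S j j' * T k k') ↔
    ∀ i', Matrix.of (B i') = ∑ i, R i i' • (Sᵀ * Matrix.of (A i) * T) := by
  refine forall_congr' fun i' => ?_
  rw [← Matrix.ext_iff]
  refine forall_congr' fun j' => forall_congr' fun k' => ?_
  simp only [Matrix.of_apply, Matrix.sum_apply, Matrix.smul_apply, Matrix.mul_apply,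
    Matrix.transpose_apply, Fin.sum_univ_two, Fin.sum_univ_three, smul_eq_mul]
  ring_nf

open Matrix in
lemma aux_build (F : Type*) [Field F] (A B : Fin 3 → Fin 2 → Fin 2 → F)
    (hA : LinearIndependent F (fun i => Matrix.of (A i)))
    (S T : Matrix (Fin 2) (Fin 2) F) (hS : IsUnit S) (hT : IsUnit T)
    (M : Matrix (Fin 3) (Fin 3) F)
    (hM : ∀ i, Sᵀ * Matrix.of (A i) * T = ∑ a, M i a • Matrix.of (B a)) :
    SpatialEquiv F A B := by
  have hMu : IsUnit M := by
    rw [← Matrix.vecMul_injective_iff_isUnit]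
    rw [← Matrix.coe_vecMulLinear, ← LinearMap.ker_eq_bot, LinearMap.ker_eq_bot']
    intro v hv
    rw [Matrix.vecMulLinear_apply] at hv
    have h1 : Sᵀ * (∑ i, v i • Matrix.of (A i)) * T = 0 := by
      rw [Finset.mul_sum, Finset.sum_mul]
      simp only [Matrix.mul_smul, Matrix.smul_mul, hM, Finset.smul_sum, smul_smul]
      rw [Finset.sum_comm]
      refine Finset.sum_eq_zero fun a _ => ?_
      rw [← Finset.sum_smul]
      have := congrFun hv a
      simp only [Matrix.vecMul, dotProduct] at this
      rw [this]; simp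
    have hSt : IsUnit Sᵀ := (Matrix.isUnit_transpose _).2 hS
    have h2 : ∑ i, v i • Matrix.of (A i) = 0 := by
      have h3 := (hT.mul_left_eq_zero).1 h1
      exact (hSt.mul_right_eq_zero).1 h3
    funext i
    exact (Fintype.linearIndependent_iff.1 hA) v h2 i
  refine ⟨(M⁻¹)ᵀ, S, T, (Matrix.isUnit_transpose _).2 ((Matrix.isUnit_nonsing_inv_iff).2 hMu),
    hS, hT, (aux_iff F A B _ S T).2 fun i' => ?_⟩
  simp only [hM, Finset.smul_sum, smul_smul]
  rw [Finset.sum_comm]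
  simp only [← Finset.sum_smul, Matrix.transpose_apply, ← Matrix.mul_apply]
  rw [Matrix.nonsing_inv_mul _ ((Matrix.isUnit_iff_isUnit_det _).1 hMu)]
  simp [Matrix.one_apply]

open Matrix in
lemma aux_annih (F : Type*) [Field F] (A B : Fin 3 → Fin 2 → Fin 2 → F)
    (C : Matrix (Fin 2) (Fin 2) F) (hC : ∀ i, (Cᵀ * Matrix.of (A i)).trace = 0)
    (h : SpatialEquiv F A B) :
    ∃ S T D : Matrix (Fin 2) (Fin 2) F, IsUnit S ∧ IsUnit T ∧ C = S * D * Tᵀ ∧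
      ∀ i, (Dᵀ * Matrix.of (B i)).trace = 0 := by
  obtain ⟨R, S, T, hR, hS, hT, h⟩ := h
  rw [aux_iff] at h
  have hSd := (Matrix.isUnit_iff_isUnit_det _).1 hS
  have hTd := (Matrix.isUnit_iff_isUnit_det _).1 hT
  have hTtd : IsUnit (Tᵀ).det := by rwa [Matrix.det_transpose]
  have hStd : IsUnit (Sᵀ).det := by rwa [Matrix.det_transpose]
  refine ⟨S, T, S⁻¹ * C * (Tᵀ)⁻¹, hS, hT, ?_, fun i => ?_⟩
  · rw [Matrix.mul_assoc, Matrix.mul_assoc, Matrix.nonsing_inv_mul _ hTtd, Matrix.mul_one,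
      ← Matrix.mul_assoc, Matrix.mul_nonsing_inv _ hSd, Matrix.one_mul]
  · rw [h, Finset.mul_sum, Matrix.trace_sum]
    refine Finset.sum_eq_zero fun a _ => ?_
    rw [Matrix.mul_smul, Matrix.trace_smul]
    have : (S⁻¹ * C * (Tᵀ)⁻¹)ᵀ * (Sᵀ * Matrix.of (A a) * T)
        = T⁻¹ * (Cᵀ * Matrix.of (A a) * T) := by
      rw [Matrix.transpose_mul, Matrix.transpose_mul, Matrix.transpose_nonsing_inv,
        Matrix.transpose_nonsing_inv, Matrix.transpose_transpose]
      simp only [Matrix.mul_assoc]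
      rw [← Matrix.mul_assoc (Sᵀ)⁻¹, Matrix.nonsing_inv_mul _ hStd, Matrix.one_mul]
    rw [this, Matrix.trace_mul_comm, Matrix.mul_assoc, Matrix.mul_nonsing_inv _ hTd,
      Matrix.mul_one, hC, smul_zero]

open Matrix in
lemma aux_transfer (F : Type*) [Field F] (N C D S T : Matrix (Fin 2) (Fin 2) F)
    (hC : (Cᵀ * N).trace = 0) (h : C = S * D * Tᵀ) : (Dᵀ * (Sᵀ * N * T)).trace = 0 := by
  rw [← hC, h, Matrix.transpose_mul, Matrix.transpose_mul, Matrix.transpose_transpose,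
    ← Matrix.mul_assoc, Matrix.trace_mul_comm]
  simp only [Matrix.mul_assoc]

lemma aux_complete (F : Type*) [Field F] (a b : F) (h : a ≠ 0 ∨ b ≠ 0) :
    ∃ x y : F, a * y - x * b ≠ 0 := by
  rcases h with h | h
  · exact ⟨0, 1, by simpa using h⟩
  · exact ⟨1, 0, by simpa using h⟩

lemma aux_uv (F : Type*) [Field F] (a b c d : F) (h0 : a * d - b * c = 0)
    (h : ¬ (a = 0 ∧ b = 0 ∧ c = 0 ∧ d = 0)) :
    ∃ p q r s : F, (p ≠ 0 ∨ q ≠ 0) ∧ (r ≠ 0 ∨ s ≠ 0) ∧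
      a = p * r ∧ b = p * s ∧ c = q * r ∧ d = q * s := by
  by_cases ha : a = 0
  · by_cases hb : b = 0
    · refine ⟨0, 1, c, d, by simp, ?_, by simp [ha], by simp [hb], by simp, by simp⟩
      by_contra! hh
      exact h ⟨ha, hb, hh.1, hh.2⟩
    · have hc : c = 0 := by
        subst ha
        have : b * c = 0 := by linear_combination -h0
        exact (mul_eq_zero.1 this).resolve_left hb
      exact ⟨b, d, 0, 1, Or.inl hb, by simp, by simp [ha], by simp, by simp [hc], by simp⟩
  · refine ⟨a, c, 1, b / a, Or.inl ha, by simp, by simp, by field_simp, by simp, ?_⟩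
    field_simp
    linear_combination h0

open Matrix in
lemma aux_rank1 (F : Type*) [Field F] (C : Matrix (Fin 2) (Fin 2) F) (hC : C ≠ 0)
    (hd : C.det = 0) : ∃ S T : Matrix (Fin 2) (Fin 2) F, IsUnit S ∧ IsUnit T ∧
      C = S * !![0, 1; 0, 0] * Tᵀ := by
  rw [Matrix.det_fin_two] at hd
  obtain ⟨p, q, r, s, h1, h2, e1, e2, e3, e4⟩ := aux_uv F _ _ _ _ hd (by
    rintro ⟨x, y, z, w⟩
    apply hC
    ext i j
    fin_cases i <;> fin_cases j <;> simpa)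
  obtain ⟨x, y, hx⟩ := aux_complete F p q h1
  obtain ⟨z, w, hz⟩ := aux_complete F r s h2
  refine ⟨!![p, x; q, y], !![z, r; w, s], ?_, ?_, ?_⟩
  · rw [Matrix.isUnit_iff_isUnit_det, isUnit_iff_ne_zero, Matrix.det_fin_two_of]
    exact hx
  · rw [Matrix.isUnit_iff_isUnit_det, isUnit_iff_ne_zero, Matrix.det_fin_two_of]
    intro h
    apply hz
    linear_combination -h
  · ext i j
    fin_cases i <;> fin_cases j <;> simp [Matrix.mul_apply, Fin.sum_univ_two, e1, e2, e3, e4]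

open Matrix in
lemma aux_rank2 (F : Type*) [Field F] (C : Matrix (Fin 2) (Fin 2) F)
    (hd : C.det ≠ 0) : ∃ S T : Matrix (Fin 2) (Fin 2) F, IsUnit S ∧ IsUnit T ∧
      C = S * !![0, 1; -1, 0] * Tᵀ := by
  refine ⟨C * !![0, -1; 1, 0], 1, ?_, isUnit_one, ?_⟩
  · rw [Matrix.isUnit_iff_isUnit_det, isUnit_iff_ne_zero, Matrix.det_mul, Matrix.det_fin_two_of]
    simpa using hd
  · ext i j
    fin_cases i <;> fin_cases j <;> simp [Matrix.mul_apply, Fin.sum_univ_two]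

open Matrix in
lemma aux_exists (F : Type*) [Field F] (A : Fin 3 → Fin 2 → Fin 2 → F) :
    ∃ C : Matrix (Fin 2) (Fin 2) F, C ≠ 0 ∧ ∀ i, (Cᵀ * Matrix.of (A i)).trace = 0 := by
  let f : Matrix (Fin 2) (Fin 2) F →ₗ[F] (Fin 3 → F) :=
    { toFun := fun C i => (Cᵀ * Matrix.of (A i)).trace
      map_add' := fun C D => by
        funext i; simp [Matrix.add_mul]
      map_smul' := fun c C => by
        funext i; simp }
  have hk : LinearMap.ker f ≠ ⊥ := by
    apply LinearMap.ker_ne_bot_of_finrank_lt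
    simp [Module.finrank_matrix]
  obtain ⟨C, hC, h0⟩ := (Submodule.ne_bot_iff _).1 hk
  exact ⟨C, h0, fun i => congrFun (LinearMap.mem_ker.1 hC) i⟩

theorem stmt_8 (F : Type*) [Field F] (hchar : (2 : F) ≠ 0)
    (A : Fin 3 → Fin 2 → Fin 2 → F) (h : SpatialRegular F A) :
    Xor'
      (SpatialEquiv F A (pairSlices (F := F) !![1, 0; 0, 1; 0, 0] !![0, 0; 0, 0; 0, 1]))
      (SpatialEquiv F A (pairSlices (F := F) !![1, 0; 0, 1; 0, 0] !![0, 0; 1, 0; 0, 1])) := by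
  have hA : LinearIndependent F (fun i => Matrix.of (A i)) := h.1
  obtain ⟨C, hC0, hC⟩ := aux_exists F A
  by_cases hd : C.det = 0
  · left
    constructor
    · obtain ⟨S, T, hS, hT, e⟩ := aux_rank1 F C hC0 hd
      refine aux_build F A _ hA S T hS hT
        (Matrix.of fun i => ![(S.transpose * Matrix.of (A i) * T) 0 0,
          (S.transpose * Matrix.of (A i) * T) 1 0, (S.transpose * Matrix.of (A i) * T) 1 1]) ?_
      intro i
      have := aux_transfer F _ _ _ _ _ (hC i) e
      simp only [Fin.sum_univ_three, Matrix.of_apply]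
      generalize S.transpose * Matrix.of (A i) * T = N at *
      simp [Matrix.trace, Matrix.mul_apply, Fin.sum_univ_two] at this
      ext j k
      fin_cases j <;> fin_cases k <;>
        simp [Fin.sum_univ_three, pairSlices, this]
    · intro h2
      obtain ⟨S, T, D, hS, hT, e, hD⟩ := aux_annih F A _ C hC h2
      have h0 := hD 0
      have h1 := hD 1
      have h2 := hD 2
      simp [Matrix.trace, Matrix.mul_apply, Fin.sum_univ_two, pairSlices] at h0 h1 h2
      have hS' := ((Matrix.isUnit_iff_isUnit_det _).1 hS).ne_zero
      have hT' := ((Matrix.isUnit_iff_isUnit_det _).1 hT).ne_zero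
      have hDd : D.det = 0 := by
        rw [e, Matrix.det_mul, Matrix.det_mul, Matrix.det_transpose] at hd
        simpa [hS', hT'] using hd
      rw [Matrix.det_fin_two, h0] at hDd
      have h3 : D 0 1 = 0 := by
        have : D 0 1 * D 0 1 = 0 := by
          linear_combination hDd + D 0 1 * h1
        exact mul_self_eq_zero.1 this
      have h4 : D 1 0 = 0 := by linear_combination h1 - h3
      apply hC0
      have : D = 0 := by
        ext j k
        fin_cases j <;> fin_cases k <;> simp [h0, h2, h3, h4]
      rw [e, this]; simp
  · right
    constructor
    · obtain ⟨S, T, hS, hT, e⟩ := aux_rank2 F C hd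
      refine aux_build F A _ hA S T hS hT
        (Matrix.of fun i => ![(S.transpose * Matrix.of (A i) * T) 0 0,
          (S.transpose * Matrix.of (A i) * T) 1 0, (S.transpose * Matrix.of (A i) * T) 1 1]) ?_
      intro i
      have := aux_transfer F _ _ _ _ _ (hC i) e
      simp only [Fin.sum_univ_three, Matrix.of_apply]
      generalize S.transpose * Matrix.of (A i) * T = N at *
      simp [Matrix.trace, Matrix.mul_apply, Fin.sum_univ_two] at this
      have h3 : N 0 1 = N 1 0 := by linear_combination this
      ext j k
      fin_cases j <;> fin_cases k <;>
        simp [Fin.sum_univ_three, pairSlices, h3]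
    · intro h2
      obtain ⟨S, T, D, hS, hT, e, hD⟩ := aux_annih F A _ C hC h2
      have h0 := hD 0
      have h1 := hD 1
      simp [Matrix.trace, Matrix.mul_apply, Fin.sum_univ_two, pairSlices] at h0 h1
      apply hd
      rw [e, Matrix.det_mul, Matrix.det_mul, Matrix.det_fin_two D, h0, h1]
      simp
end

section
/- Every regular spatial matrix of size 4×2×2 over a field F is equivalent to the 4×2×2 spatial matrix whose two frontal slices are ![![1,0],![0,1],![0,0],![0,0]] and ![![0,0],![0,0],![1,0],![0,1]] (form (a14z)). -/
/-- Every regular 4×2×2 spatial matrix is equivalent to the form (a14z). -/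
theorem stmt_9 (F : Type*) [Field F]
    (A : Fin 4 → Fin 2 → Fin 2 → F) (h : SpatialRegular F A) :
    SpatialEquiv F A
      (pairSlices (F := F) !![1, 0; 0, 1; 0, 0; 0, 0] !![0, 0; 0, 0; 1, 0; 0, 1]) := by
  let M : Matrix (Fin 4) (Fin 4) F := Matrix.of fun i c => ![A i 0 0, A i 1 0, A i 0 1, A i 1 1] c
  have hM : IsUnit M := by
    rw [← Matrix.linearIndependent_rows_iff_isUnit, Fintype.linearIndependent_iff]
    intro g hg
    refine (Fintype.linearIndependent_iff.1 h.1) g ?_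
    have h0 := congrFun hg 0
    have h1 := congrFun hg 1
    have h2 := congrFun hg 2
    have h3 := congrFun hg 3
    simp [M, Fin.sum_univ_four, Matrix.row] at h0 h1 h2 h3
    ext j k
    fin_cases j <;> fin_cases k <;> simp [Fin.sum_univ_four, h0, h1, h2, h3]
  have hd : IsUnit M.det := (Matrix.isUnit_iff_isUnit_det M).1 hM
  have hinv : M⁻¹ * M = 1 := Matrix.nonsing_inv_mul M hd
  refine ⟨(M⁻¹).transpose, 1, 1, ?_, isUnit_one, isUnit_one, ?_⟩
  · rw [Matrix.isUnit_iff_isUnit_det, Matrix.det_transpose]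
    exact Matrix.isUnit_nonsing_inv_det M hd
  · intro i' j' k'
    have key : ∀ c, ∑ i, M i c * M⁻¹ i' i = (1 : Matrix (Fin 4) (Fin 4) F) i' c := by
      intro c
      rw [← hinv, Matrix.mul_apply]
      exact Finset.sum_congr rfl fun i _ => mul_comm _ _
    have e : ∑ i, ∑ j, ∑ k, A i j k * (M⁻¹).transpose i i' * (1 : Matrix (Fin 2) (Fin 2) F) j j'
        * (1 : Matrix (Fin 2) (Fin 2) F) k k' = ∑ i, A i j' k' * M⁻¹ i' i := by
      refine Finset.sum_congr rfl fun i _ => ?_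
      simp [Matrix.one_apply]
    rw [e]
    have k0 := key 0
    have k1 := key 1
    have k2 := key 2
    have k3 := key 3
    have m0 : ∀ i, M i 0 = A i 0 0 := fun _ => rfl
    have m1 : ∀ i, M i 1 = A i 1 0 := fun _ => rfl
    have m2 : ∀ i, M i 2 = A i 0 1 := fun _ => rfl
    have m3 : ∀ i, M i 3 = A i 1 1 := fun _ => rfl
    simp only [m0, m1, m2, m3] at k0 k1 k2 k3
    clear_value M
    fin_cases j' <;> fin_cases k' <;>
      simp only [Fin.zero_eta, Fin.mk_one, Fin.isValue, k0, k1, k2, k3] <;>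
      fin_cases i' <;> simp [pairSlices, Matrix.one_apply]
end

section
/- Over any field F, the 3×2×2 spatial matrix (a12), with frontal slices ![![1,0],![0,1],![0,0]] and ![![0,0],![0,0],![0,1]], is not equivalent to the 3×2×2 spatial matrix (a12a), with frontal slices ![![1,0],![0,1],![0,0]] and ![![0,0],![1,0],![0,1]]. -/
/-- The spatial matrix (a12) is not equivalent to (a12a). -/
theorem stmt_11 (F : Type*) [Field F] :
    ¬ SpatialEquiv F
      (pairSlices (F := F) !![1, 0; 0, 1; 0, 0] !![0, 0; 0, 0; 0, 1])
      (pairSlices (F := F) !![1, 0; 0, 1; 0, 0] !![0, 0; 1, 0; 0, 1]) := by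
  rintro ⟨R, S, T, -, -, hT, h⟩
  rw [Matrix.isUnit_iff_isUnit_det, Matrix.det_fin_two] at hT
  have h00 := h 0 0 0
  have h01 := h 0 0 1
  have h10 := h 0 1 0
  have h11 := h 0 1 1
  have k00 := h 1 0 0
  have k01 := h 1 0 1
  have k10 := h 1 1 0
  have k11 := h 1 1 1
  have l00 := h 2 0 0
  have l01 := h 2 0 1
  have l10 := h 2 1 0
  have l11 := h 2 1 1
  clear h
  simp [pairSlices, Fin.sum_univ_succ] at h00 h01 h10 h11 k00 k01 k10 k11 l00 l01 l10 l11
  set d := T 0 0 * T 1 1 - T 0 1 * T 1 0 with hd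
  have a0 : ∀ i : Fin 3, ∀ j : Fin 2, ∀ x y : F,
      x = R 0 i * S 0 j * T 0 0 + (R 1 i * S 1 j * T 0 0 + R 2 i * S 1 j * T 1 0) →
      y = R 0 i * S 0 j * T 0 1 + (R 1 i * S 1 j * T 0 1 + R 2 i * S 1 j * T 1 1) →
      T 0 1 * x - T 0 0 * y = -(d * R 2 i) * S 1 j := by
    intro i j x y hx hy
    rw [hx, hy, hd]; ring
  have p0 := a0 0 0 _ _ h00 h01
  have p1 := a0 0 1 _ _ h10 h11
  have q0 := a0 1 0 _ _ k00 k01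
  have q1 := a0 1 1 _ _ k10 k11
  have r0 := a0 2 0 _ _ l00 l01
  have r1 := a0 2 1 _ _ l10 l11
  clear_value d
  generalize -(d * R 2 0) = u at *
  generalize -(d * R 2 1) = v at *
  generalize -(d * R 2 2) = w at *
  have z0 : T 0 1 ^ 2 = 0 := by
    have : T 0 1 ^ 2 = (u * S 1 1) * (v * S 1 0) := by
      calc T 0 1 ^ 2 = (T 0 1 * 1 - T 0 0 * 0) * (T 0 1 * 1 - T 0 0 * 0) := by ring
        _ = (u * S 1 0) * (v * S 1 1) := by rw [← p0, ← q1]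
        _ = _ := by ring
    rw [this, ← p1]; ring
  have z1 : T 0 0 ^ 2 = 0 := by
    have : T 0 0 ^ 2 = (v * S 1 1) * (w * S 1 0) := by
      calc T 0 0 ^ 2 = (T 0 1 * 0 - T 0 0 * 1) * (T 0 1 * 0 - T 0 0 * 1) := by ring
        _ = (v * S 1 0) * (w * S 1 1) := by rw [← q0, ← r1]
        _ = _ := by ring
    rw [this, ← r0]; ring
  have y0 : T 0 1 = 0 := by simpa using z0
  have y1 : T 0 0 = 0 := by simpa using z1
  rw [hd, y0, y1] at hT
  simp at hT
end

section
/- Let F be a field and let a, b ∈ F. If a = b·z² for some nonzero z ∈ F, then the 2×2×2 spatial matrices ‖I₂ | B(a)‖ and ‖I₂ | B(b)‖ are equivalent. -/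
/-- If `a = b * z ^ 2` with `z ≠ 0`, then `‖I₂|B(a)‖` and `‖I₂|B(b)‖` are equivalent. -/
theorem stmt_12 (F : Type*) [Field F] (a b : F)
    (h : ∃ z : F, z ≠ 0 ∧ a = b * z ^ 2) :
    SpatialEquiv F
      (pairSlices (1 : Matrix (Fin 2) (Fin 2) F) !![0, a; 1, 0])
      (pairSlices (1 : Matrix (Fin 2) (Fin 2) F) !![0, b; 1, 0]) := by
  obtain ⟨z, hz, rfl⟩ := h
  refine ⟨!![1, 0; 0, z], !![1, 0; 0, z⁻¹], !![1, 0; 0, z⁻¹], ?_, ?_, ?_, ?_⟩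
  · simp [Matrix.isUnit_iff_isUnit_det, Matrix.det_fin_two, hz]
  · simp [Matrix.isUnit_iff_isUnit_det, Matrix.det_fin_two, hz]
  · simp [Matrix.isUnit_iff_isUnit_det, Matrix.det_fin_two, hz]
  · intro i j k
    fin_cases i <;> fin_cases j <;> fin_cases k <;>
      simp [pairSlices, Fin.sum_univ_two, hz] <;> field_simp
end

section
/- Let F be a field of characteristic different from 2 and let a, b ∈ F. If the 2×2×2 spatial matrices ‖I₂ | B(a)‖ and ‖I₂ | B(b)‖ are equivalent, then there exists a nonzero z ∈ F with a = b·z². -/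
/-- Over a field of characteristic not two, if `‖I₂|B(a)‖` and `‖I₂|B(b)‖` are
equivalent, then `a = b * z ^ 2` for some nonzero `z`. -/
theorem stmt_13 (F : Type*) [Field F] (hchar : (2 : F) ≠ 0) (a b : F)
    (h : SpatialEquiv F
      (pairSlices (1 : Matrix (Fin 2) (Fin 2) F) !![0, a; 1, 0])
      (pairSlices (1 : Matrix (Fin 2) (Fin 2) F) !![0, b; 1, 0])) :
    ∃ z : F, z ≠ 0 ∧ a = b * z ^ 2 := by
  obtain ⟨R, S, T, hR, hS, hT, h⟩ := h
  have hR' := ((Matrix.isUnit_iff_isUnit_det R).1 hR).ne_zero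
  have hS' := ((Matrix.isUnit_iff_isUnit_det S).1 hS).ne_zero
  have hT' := ((Matrix.isUnit_iff_isUnit_det T).1 hT).ne_zero
  have h000 := h 0 0 0
  have h010 := h 0 1 0
  have h100 := h 1 0 0
  have h110 := h 1 1 0
  have h001 := h 0 0 1
  have h011 := h 0 1 1
  have h101 := h 1 0 1
  have h111 := h 1 1 1
  simp [pairSlices, Fin.sum_univ_two] at h000 h010 h100 h110 h001 h011 h101 h111
  have mm : ∀ {p q r s : F}, p = q → r = s → p * r = q * s := fun h1 h2 => by rw [h1, h2]
  have e0 : (1 : F) = R.det * S.det * (T 0 0 ^ 2 - a * T 1 0 ^ 2) := by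
    have : (1 : F) = 1 * 1 - 0 * 0 := by ring
    rw [this]
    nth_rewrite 1 [h000]
    nth_rewrite 1 [h110]
    nth_rewrite 1 [h010]
    nth_rewrite 1 [h100]
    rw [Matrix.det_fin_two, Matrix.det_fin_two]; ring
  have e1 : -b = R.det * S.det * (T 0 1 ^ 2 - a * T 1 1 ^ 2) := by
    rw [Matrix.det_fin_two, Matrix.det_fin_two]
    linear_combination (mm h001 h111) - (mm h011 h101)
  have e2 : 0 = 2 * (R.det * S.det * (T 0 0 * T 0 1 - a * T 1 0 * T 1 1)) := by
    rw [Matrix.det_fin_two, Matrix.det_fin_two]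
    linear_combination (mm h000 h111) + (mm h001 h110) - (mm h010 h101) - (mm h011 h100)
  have e3 : R.det * S.det * (T 0 0 * T 0 1 - a * T 1 0 * T 1 1) = 0 := by
    simpa [hchar] using e2.symm
  have e4 : b = a * (R.det * S.det * T.det) ^ 2 := by
    have hd := Matrix.det_fin_two T
    rw [hd]
    generalize R.det * S.det = c at *
    linear_combination -(mm e0 e1) - (mm e3 e3)
  have hz : R.det * S.det * T.det ≠ 0 := mul_ne_zero (mul_ne_zero hR' hS') hT'
  refine ⟨(R.det * S.det * T.det)⁻¹, inv_ne_zero hz, ?_⟩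
  rw [e4]
  field_simp
end

section
/- Let F be a field and let A, B be 2×2 matrices over F such that the 2×2×2 spatial matrix with frontal slices A and B is regular. Then there exist α, β ∈ F such that α•A + β•B is an invertible 2×2 matrix. -/
theorem minor_aux {F : Type*} [Field F] (x₁ x₂ x₃ x₄ y₁ y₂ y₃ y₄ : F)
    (H : ∀ s t : F, s * x₁ + t * y₁ = 0 → s * x₂ + t * y₂ = 0 → s * x₃ + t * y₃ = 0 →
      s * x₄ + t * y₄ = 0 → s = 0 ∧ t = 0) :
    x₁ * y₂ - x₂ * y₁ ≠ 0 ∨ x₁ * y₃ - x₃ * y₁ ≠ 0 ∨ x₁ * y₄ - x₄ * y₁ ≠ 0 ∨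
    x₂ * y₃ - x₃ * y₂ ≠ 0 ∨ x₂ * y₄ - x₄ * y₂ ≠ 0 ∨ x₃ * y₄ - x₄ * y₃ ≠ 0 := by
  by_contra! hc
  obtain ⟨h1, h2, h3, h4, h5, h6⟩ := hc
  have e1 : x₁ = 0 := neg_eq_zero.1 (H y₁ (-x₁) (by ring) (by linear_combination -h1)
    (by linear_combination -h2) (by linear_combination -h3)).2
  have e2 : x₂ = 0 := neg_eq_zero.1 (H y₂ (-x₂) (by linear_combination h1) (by ring)
    (by linear_combination -h4) (by linear_combination -h5)).2
  have e3 : x₃ = 0 := neg_eq_zero.1 (H y₃ (-x₃) (by linear_combination h2)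
    (by linear_combination h4) (by ring) (by linear_combination -h6)).2
  have e4 : x₄ = 0 := neg_eq_zero.1 (H y₄ (-x₄) (by linear_combination h3)
    (by linear_combination h5) (by linear_combination h6) (by ring)).2
  exact one_ne_zero (H 1 0 (by simp [e1]) (by simp [e2]) (by simp [e3]) (by simp [e4])).1

/-- If the 2×2×2 spatial matrix with frontal slices `A` and `B` is regular, then some
linear combination `α•A + β•B` is invertible. -/
theorem stmt_15 (F : Type*) [Field F] (A B : Matrix (Fin 2) (Fin 2) F)
    (h : SpatialRegular F (pairSlices A B)) :
    ∃ α β : F, IsUnit (α • A + β • B) := by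
  obtain ⟨hr, hcl, -⟩ := h
  rw [Fintype.linearIndependent_iff] at hr hcl
  have R := minor_aux (A 0 0) (A 0 1) (B 0 0) (B 0 1) (A 1 0) (A 1 1) (B 1 0) (B 1 1) (by
    intro s t h1 h2 h3 h4
    have := hr ![s, t] (by
      ext j k
      fin_cases j <;> fin_cases k <;> simp [Fin.sum_univ_two, pairSlices, h1, h2, h3, h4])
    exact ⟨this 0, this 1⟩)
  have C := minor_aux (A 0 0) (A 1 0) (B 0 0) (B 1 0) (A 0 1) (A 1 1) (B 0 1) (B 1 1) (by
    intro s t h1 h2 h3 h4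
    have := hcl ![s, t] (by
      ext j k
      fin_cases j <;> fin_cases k <;> simp [Fin.sum_univ_two, pairSlices, h1, h2, h3, h4])
    exact ⟨this 0, this 1⟩)
  by_contra! hn
  have key : ∀ α β : F, (α * A 0 0 + β * B 0 0) * (α * A 1 1 + β * B 1 1)
      - (α * A 0 1 + β * B 0 1) * (α * A 1 0 + β * B 1 0) = 0 := by
    intro α β
    have := hn α β
    rw [Matrix.isUnit_iff_isUnit_det, isUnit_iff_ne_zero, not_not, Matrix.det_fin_two] at this
    simpa using this
  have k1 := key 1 0
  have k2 := key 0 1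
  have k3 := key 1 1
  clear hr hcl hn key
  generalize A 0 0 = a at *
  generalize A 0 1 = b at *
  generalize A 1 0 = c at *
  generalize A 1 1 = d at *
  generalize B 0 0 = e at *
  generalize B 0 1 = f at *
  generalize B 1 0 = g at *
  generalize B 1 1 = h at *
  simp only [one_mul, zero_mul, add_zero, zero_add] at k1 k2 k3
  rcases R with R | R | R | R | R | R <;> rcases C with C | C | C | C | C | C <;>
    first
    | exact R (by linear_combination k1)
    | exact R (by linear_combination k2)
    | exact C (by linear_combination k1)
    | exact C (by linear_combination k2)
    | (have := mul_ne_zero R C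
       clear R C
       grind)
end
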